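/- arXiv:1401.2709 — 2 statements merged into one kernel-verified Lean document; each statement's English description precedes it below -/
import Mathlib

section
/- Let μ ∈ ℝ, σ > 0, n ≥ 2. Under the product Gaussian measure N(μ,σ²)^⊗n on ℝⁿ, the statistic SS(x)/σ² = Σ_{k=1}^n (xₖ − μ̄(x))²/σ² has the chi-squared distribution with n−1 degrees of freedom; i.e., for every Borel set Ξ ⊆ (0,∞), N(μ,σ²)^⊗n({x : SS(x) ∈ Ξ}) = ∫_{Ξ/σ²} p^{χ²}_{n−1}(t) dt, where p^{χ²}_{n−1}(t) = t^{(n−1)/2−1} e^{−t/2} / (2^{(n−1)/2} Γ((n−1)/2)). -/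
open MeasureTheory ProbabilityTheory

/-- The chi-squared density with `d` degrees of freedom. -/
noncomputable def chiSqPDF (d : ℕ) (t : ℝ) : ℝ :=
  t ^ ((d : ℝ) / 2 - 1) * Real.exp (-t / 2) / (2 ^ ((d : ℝ) / 2) * Real.Gamma ((d : ℝ) / 2))

lemma gammaPDFReal_half_eq_chiSqPDF (d : ℕ) {t : ℝ} (ht : 0 ≤ t) :
    gammaPDFReal ((d : ℝ) / 2) (1 / 2) t = chiSqPDF d t := by
  rw [gammaPDFReal, if_pos ht, chiSqPDF, Real.div_rpow zero_le_one zero_le_two, Real.one_rpow,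
    show -t / 2 = -(1 / 2 * t) by ring]
  ring

lemma gammaMeasure_apply_eq_integral {a r : ℝ} (ha : 0 < a) (hr : 0 < r) {s : Set ℝ}
    (hs : MeasurableSet s) :
    gammaMeasure a r s = ENNReal.ofReal (∫ t in s, gammaPDFReal a r t) := by
  have hint : Integrable (gammaPDFReal a r) := by
    refine ⟨(measurable_gammaPDFReal a r).aestronglyMeasurable, ?_⟩
    rw [hasFiniteIntegral_iff_ofReal (ae_of_all _ (gammaPDFReal_nonneg ha hr))]
    exact (lintegral_gammaPDF_eq_one ha hr).trans_lt ENNReal.one_lt_top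
  rw [gammaMeasure, withDensity_apply _ hs, ofReal_integral_eq_lintegral_ofReal hint.integrableOn
    (ae_of_all _ (gammaPDFReal_nonneg ha hr))]
  rfl

lemma mgf_id_gammaMeasure {a r : ℝ} (ha : 0 < a) (hr : 0 < r) (t : ℝ) :
    mgf id (gammaMeasure a r) t = if t < r then (r / (r - t)) ^ a else 0 := by
  have hpdf : mgf id (gammaMeasure a r) t =
      r ^ a / Real.Gamma a * ∫ x in Set.Ioi (0 : ℝ), x ^ (a - 1) * Real.exp (-((r - t) * x)) := by
    rw [mgf, gammaMeasure, integral_withDensity_eq_integral_toReal_smul (f := gammaPDF a r)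
      (measurable_gammaPDFReal a r).ennreal_ofReal (ae_of_all _ fun _ ↦ ENNReal.ofReal_lt_top),
      ← integral_const_mul, ← integral_Ici_eq_integral_Ioi, ← integral_indicator measurableSet_Ici]
    congr with x
    rw [gammaPDF, ENNReal.toReal_ofReal (gammaPDFReal_nonneg ha hr x), gammaPDFReal]
    by_cases hx : 0 ≤ x
    · rw [if_pos hx, Set.indicator_of_mem (Set.mem_Ici.2 hx), smul_eq_mul, mul_assoc, mul_assoc,
        ← Real.exp_add]
      congr 3
      simp only [id]
      ring
    · rw [if_neg hx, Set.indicator_of_notMem (by simpa using hx), zero_smul]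
  rw [hpdf]
  split_ifs with h
  · rw [Real.integral_rpow_mul_exp_neg_mul_Ioi ha (sub_pos.2 h),
      Real.div_rpow hr.le (sub_pos.2 h).le, Real.div_rpow zero_le_one (sub_pos.2 h).le,
      Real.one_rpow]
    have := (Real.Gamma_pos_of_pos ha).ne'
    field_simp
  · rw [integral_undef, mul_zero]
    intro hint
    refine not_integrableOn_Ioi_rpow (a - 1) (Integrable.mono hint (by fun_prop) ?_)
    refine (ae_restrict_iff' measurableSet_Ioi).2 (ae_of_all _ fun x (hx : 0 < x) ↦ ?_)
    rw [norm_mul]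
    refine le_mul_of_one_le_right (norm_nonneg _) ?_
    rw [Real.norm_eq_abs, Real.abs_exp]
    exact Real.one_le_exp (by nlinarith)

lemma mgf_sq_gaussianReal (t : ℝ) :
    mgf (fun x : ℝ ↦ x ^ 2) (gaussianReal 0 1) t = √(1 / 2 / (1 / 2 - t)) := by
  rw [mgf, integral_gaussianReal_eq_integral_smul one_ne_zero]
  have (x : ℝ) : gaussianPDFReal 0 1 x • Real.exp (t * x ^ 2) =
      (√(2 * Real.pi))⁻¹ * Real.exp (-(1 / 2 - t) * x ^ 2) := by
    rw [gaussianPDFReal, smul_eq_mul, mul_assoc, ← Real.exp_add]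
    simp only [NNReal.coe_one]
    congr 2
    · ring_nf
    · ring
  simp_rw [this]
  rw [integral_const_mul, integral_gaussian, ← Real.sqrt_inv, ← Real.sqrt_mul (by positivity)]
  congr 1
  have := Real.pi_ne_zero
  rw [mul_div_assoc']
  congr 1
  field_simp

/-- Probability measures on `ℝ` with the same moment-generating function, finite near `0`, are
equal. -/
lemma Measure.ext_of_mgf_id_eq {μ ν : Measure ℝ} [IsProbabilityMeasure μ]
    [IsProbabilityMeasure ν] (h : mgf id μ = mgf id ν)
    (h0 : 0 ∈ interior (integrableExpSet id μ)) : μ = ν := by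
  refine Measure.ext_of_charFun (funext fun t ↦ ?_)
  rw [← complexMGF_id_mul_I, ← complexMGF_id_mul_I]
  exact eqOn_complexMGF_of_mgf h (by simpa using h0)

/-- A sum of `d ≥ 1` squares of independent standard Gaussians has the Gamma distribution with
shape `d / 2` and rate `1 / 2`, that is, the chi-squared distribution. -/
lemma map_sum_sq_pi_gaussianReal {ι : Type*} [Fintype ι] {s : Finset ι} (hs : s.Nonempty) :
    (Measure.pi fun _ : ι ↦ gaussianReal 0 1).map (fun y ↦ ∑ i ∈ s, y i ^ 2) =
      gammaMeasure ((s.card : ℝ) / 2) (1 / 2) := by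
  have ha : (0 : ℝ) < s.card / 2 := by have := hs.card_pos; positivity
  have : IsProbabilityMeasure (gammaMeasure ((s.card : ℝ) / 2) (1 / 2)) :=
    isProbabilityMeasure_gammaMeasure ha one_half_pos
  have hm : Measurable (fun y : ι → ℝ ↦ ∑ i ∈ s, y i ^ 2) := by fun_prop
  have := Measure.isProbabilityMeasure_map (μ := Measure.pi fun _ : ι ↦ gaussianReal 0 1)
    hm.aemeasurable
  symm
  apply Measure.ext_of_mgf_id_eq
  · ext t
    rw [mgf_id_gammaMeasure ha one_half_pos, mgf_id_map hm.aemeasurable]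
    have hind := (iIndepFun_pi (μ := fun _ : ι ↦ gaussianReal 0 1)
      (X := fun _ x ↦ x ^ 2) (fun _ ↦ by fun_prop)).mgf_sum (t := t) (by fun_prop) s
    have hfun : (fun y : ι → ℝ ↦ ∑ i ∈ s, y i ^ 2) = ∑ i ∈ s, fun y : ι → ℝ ↦ y i ^ 2 := by
      ext; simp
    have hcoord (i : ι) : mgf (fun y : ι → ℝ ↦ y i ^ 2)
        (Measure.pi fun _ : ι ↦ gaussianReal 0 1) t = √(1 / 2 / (1 / 2 - t)) := by
      have hmap := mgf_map (μ := Measure.pi fun _ : ι ↦ gaussianReal 0 1) (Y := Function.eval i)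
        (X := fun x ↦ x ^ 2) (t := t) (measurable_pi_apply i).aemeasurable (by fun_prop)
      rw [(measurePreserving_eval (fun _ : ι ↦ gaussianReal 0 1) i).map_eq] at hmap
      exact hmap.symm.trans (mgf_sq_gaussianReal t)
    rw [hfun, hind]
    simp_rw [hcoord]
    rw [Finset.prod_const]
    split_ifs with h
    · have : 0 < 1 / 2 - t := by linarith
      rw [Real.sqrt_eq_rpow, ← Real.rpow_mul_natCast (by positivity)]
      congr 1
      ring
    · rw [Real.sqrt_eq_zero_of_nonpos, zero_pow hs.card_pos.ne']
      exact div_nonpos_of_nonneg_of_nonpos (by norm_num) (by linarith)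
  · refine mem_interior.2 ⟨Set.Iio (1 / 2), fun t (ht : t < 1 / 2) ↦ ?_, isOpen_Iio, by simp⟩
    by_contra h
    have h0 : mgf id (gammaMeasure ((s.card : ℝ) / 2) (1 / 2)) t = 0 := mgf_undef h
    rw [mgf_id_gammaMeasure ha one_half_pos, if_pos ht] at h0
    have : 0 < 1 / 2 - t := by linarith
    exact (Real.rpow_pos_of_pos (by positivity) _).ne' h0

lemma sum_sq_sub_average {n : ℕ} (hn : n ≠ 0) (x : Fin n → ℝ) :
    ∑ k, (x k - (∑ j, x j) / n) ^ 2 = ∑ k, x k ^ 2 - (∑ j, x j) ^ 2 / n := by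
  have : (n : ℝ) ≠ 0 := by exact_mod_cast hn
  simp_rw [sub_sq, Finset.sum_add_distrib, Finset.sum_sub_distrib, ← Finset.sum_mul,
    ← Finset.mul_sum]
  simp
  field_simp
  ring

/-- In an orthonormal basis containing the normalized all-ones vector at index `i₀`, the sum of
squared deviations from the mean is the sum of the squares of the other coordinates. -/
lemma exists_orthonormalBasis_sum_sq_sub_average {n : ℕ} (i₀ : Fin n) :
    ∃ b : OrthonormalBasis (Fin n) ℝ (EuclideanSpace ℝ (Fin n)), ∀ z : EuclideanSpace ℝ (Fin n),
      ∑ k, (z k - (∑ j, z j) / n) ^ 2 = ∑ i ∈ Finset.univ.erase i₀, b.repr z i ^ 2 := by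
  have hn : n ≠ 0 := i₀.pos.ne'
  let u : EuclideanSpace ℝ (Fin n) := WithLp.toLp 2 fun _ ↦ (√n)⁻¹
  have hu : ‖u‖ = 1 := by
    rw [EuclideanSpace.norm_eq]
    simp [u, hn]
  have hv : Orthonormal ℝ (({i₀} : Set (Fin n)).domRestrict fun _ ↦ u) :=
    ⟨fun _ ↦ hu, fun i j hij ↦ (hij (Subsingleton.elim i j)).elim⟩
  obtain ⟨b, hb⟩ := hv.exists_orthonormalBasis_extension_of_card_eq (by simp)
  refine ⟨b, fun z ↦ ?_⟩
  have hsum : ∑ i, b.repr z i ^ 2 = ∑ k, z k ^ 2 := by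
    rw [← EuclideanSpace.real_norm_sq_eq, ← EuclideanSpace.real_norm_sq_eq, b.repr.norm_map]
  have h₀ : b.repr z i₀ ^ 2 = (∑ j, z j) ^ 2 / n := by
    rw [b.repr_apply_apply, hb i₀ rfl, PiLp.inner_apply]
    simp [u, ← Finset.sum_mul, mul_pow, div_eq_mul_inv]
  rw [sum_sq_sub_average hn, ← hsum, ← h₀, ← Finset.add_sum_erase _ _ (Finset.mem_univ i₀),
    add_sub_cancel_left]

lemma map_sum_sq_sub_average_pi_gaussianReal {n : ℕ} (hn : 2 ≤ n) :
    (Measure.pi fun _ : Fin n ↦ gaussianReal 0 1).map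
        (fun z : Fin n → ℝ ↦ ∑ k, (z k - (∑ j, z j) / (n : ℝ)) ^ 2) =
      gammaMeasure (((n - 1 : ℕ) : ℝ) / 2) (1 / 2) := by
  let i₀ : Fin n := ⟨0, by omega⟩
  obtain ⟨b, hb⟩ := exists_orthonormalBasis_sum_sq_sub_average i₀
  have hcard : (Finset.univ.erase i₀).card = n - 1 := by simp
  rw [← hcard, ← map_sum_sq_pi_gaussianReal (Finset.card_pos.1 (by omega))]
  have hstd := map_pi_eq_stdGaussian (ι := Fin n)
  rw [stdGaussian_eq_map_pi_orthonormalBasis b] at hstd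
  have h := congrArg (Measure.map fun z : EuclideanSpace ℝ (Fin n) ↦
    ∑ k, (z k - (∑ j, z j) / n) ^ 2) hstd
  rw [Measure.map_map (by fun_prop) (by fun_prop), Measure.map_map (by fun_prop) (by fun_prop)] at h
  refine h.trans (congrArg (Measure.map · _) (funext fun y ↦ ?_))
  simp only [Function.comp_apply]
  have hrepr := b.sum_repr_symm (WithLp.toLp 2 y)
  simp only at hrepr
  rw [hb, hrepr, b.repr.apply_symm_apply]

/-- Under `N(μ,σ²)^⊗n`, `SS(x)/σ²` has the chi-squared distribution with `n−1` degrees of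
freedom: for every Borel set `Ξ ⊆ (0,∞)`,
`N(μ,σ²)^⊗n({x : SS(x) ∈ Ξ}) = ∫_{Ξ/σ²} p^{χ²}_{n−1}(t) dt`. -/
theorem sumSqDev_chiSq (μ σ : ℝ) (hσ : 0 < σ) (n : ℕ) (hn : 2 ≤ n) :
    ∀ Ξ : Set ℝ, MeasurableSet Ξ → Ξ ⊆ Set.Ioi 0 →
      (Measure.pi fun _ : Fin n => gaussianReal μ ⟨σ ^ 2, sq_nonneg σ⟩)
          {x | (∑ k, (x k - (∑ j, x j) / n) ^ 2) ∈ Ξ} =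
        ENNReal.ofReal (∫ t in (fun s => s / σ ^ 2) '' Ξ, chiSqPDF (n - 1) t) := by
  intro Ξ hΞ hpos
  change (Measure.pi fun _ : Fin n ↦ gaussianReal μ (.mk (σ ^ 2) (sq_nonneg σ))) _ = _
  have hn0 : (n : ℝ) ≠ 0 := by positivity
  have himage : (fun s ↦ s / σ ^ 2) '' Ξ = (fun s ↦ σ ^ 2 * s) ⁻¹' Ξ := by
    refine congrFun (Set.image_eq_preimage_of_inverse (fun s ↦ ?_) fun s ↦ ?_) Ξ <;> field_simp
  have hmeas : MeasurableSet ((fun s ↦ s / σ ^ 2) '' Ξ) := by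
    rw [himage]
    exact hΞ.preimage (by fun_prop)
  have hlaw : (gaussianReal 0 1).map (fun z ↦ σ * z + μ) =
      gaussianReal μ (.mk (σ ^ 2) (sq_nonneg σ)) := by
    rw [← Function.comp_def (· + μ) (σ * ·), ← Measure.map_map (by fun_prop) (by fun_prop),
      gaussianReal_map_const_mul, gaussianReal_map_add_const]
    simp
  have hpi := Measure.pi_map_pi (ι := Fin n) (μ := fun _ ↦ gaussianReal 0 1)
    (f := fun _ z ↦ σ * z + μ) (hμ := fun _ ↦ by rw [hlaw]; infer_instance) (fun _ ↦ by fun_prop)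
  have hscale (z : Fin n → ℝ) :
      ∑ k, (σ * z k + μ - (∑ j, (σ * z j + μ)) / n) ^ 2 =
        σ ^ 2 * ∑ k, (z k - (∑ j, z j) / n) ^ 2 := by
    rw [Finset.mul_sum, Finset.sum_add_distrib, ← Finset.mul_sum]
    refine Finset.sum_congr rfl fun k _ ↦ ?_
    simp
    field_simp
    ring
  have hd : (0 : ℝ) < ((n - 1 : ℕ) : ℝ) / 2 := by
    have : 0 < n - 1 := by omega
    positivity
  have hSS : Measurable fun x : Fin n → ℝ ↦ ∑ k, (x k - (∑ j, x j) / n) ^ 2 := by fun_prop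
  have hSSΞ : MeasurableSet {x : Fin n → ℝ | ∑ k, (x k - (∑ j, x j) / n) ^ 2 ∈ Ξ} := hSS hΞ
  simp_rw [hlaw] at hpi
  rw [← hpi, Measure.map_apply (by fun_prop) hSSΞ]
  calc _ = (Measure.pi fun _ : Fin n ↦ gaussianReal 0 1)
        ((fun z ↦ ∑ k, (z k - (∑ j, z j) / n) ^ 2) ⁻¹' ((fun s ↦ s / σ ^ 2) '' Ξ)) := by
        rw [himage]
        congr 1 with z
        simp only [Set.mem_preimage, Set.mem_ofPred_eq, hscale]
    _ = _ := by
        rw [← Measure.map_apply hSS hmeas, map_sum_sq_sub_average_pi_gaussianReal hn,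
          gammaMeasure_apply_eq_integral hd one_half_pos hmeas]
        congr 1
        refine setIntegral_congr_fun hmeas ?_
        rintro _ ⟨s, hs, rfl⟩
        exact gammaPDFReal_half_eq_chiSqPDF _ (div_nonneg (hpos hs).le (sq_nonneg σ))
end

section
/- Let f : ℝⁿ → [0,∞) be a probability density that is invariant under simultaneous scaling adapted as follows: if X₁,...,Xₙ are i.i.d. N(0,1) with n ≥ 2, then the statistic T(x) = μ̄(x)/(σ̄'(x)/√n), where σ̄'(x) = √(Σ(xₖ−μ̄(x))²/(n−1)), has Student's t-distribution with n−1 degrees of freedom: for all η > 0, P(|T| ≥ η) = 1 − ∫_{−η}^{η} p^t_{n−1}(s) ds, where p^t_{n−1}(s) = Γ(n/2)/(√((n−1)π) Γ((n−1)/2)) · (1 + s²/(n−1))^{−n/2}. -/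
open MeasureTheory ProbabilityTheory

/-- Student's t-density with `d` degrees of freedom. -/
noncomputable def tPDF (d : ℕ) (s : ℝ) : ℝ :=
  Real.Gamma (((d : ℝ) + 1) / 2) /
    (Real.sqrt ((d : ℝ) * Real.pi) * Real.Gamma ((d : ℝ) / 2)) *
    (1 + s ^ 2 / d) ^ (-((d : ℝ) + 1) / 2)

/-- The standard Gaussian product measure has density proportional to `exp (-(∑ xᵢ²) / 2)`. -/
lemma pi_gaussianReal_eq_withDensity (ι : Type*) [Fintype ι] :
    (Measure.pi fun _ : ι => gaussianReal 0 1) =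
      (volume : Measure (ι → ℝ)).withDensity fun x =>
        ENNReal.ofReal ((√(2 * Real.pi))⁻¹ ^ Fintype.card ι * Real.exp (-(∑ i, x i ^ 2) / 2)) := by
  have hprod (x : ι → ℝ) : (√(2 * Real.pi))⁻¹ ^ Fintype.card ι *
      Real.exp (-(∑ i, x i ^ 2) / 2) = ∏ i, gaussianPDFReal 0 1 (x i) := by
    simp [gaussianPDFReal_def, Finset.prod_mul_distrib, ← Real.exp_sum, Finset.sum_div, neg_div]
  simp_rw [hprod]
  refine Measure.pi_eq fun s hs => ?_
  rw [withDensity_apply _ (MeasurableSet.univ_pi hs), volume_pi, Measure.restrict_pi_pi,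
    ← ofReal_integral_eq_lintegral_ofReal, integral_fintype_prod_eq_prod,
    ENNReal.ofReal_prod_of_nonneg]
  · simp_rw [gaussianReal_apply_eq_integral 0 one_ne_zero]
  · exact fun i _ => integral_nonneg (gaussianPDFReal_nonneg _ _)
  · exact Integrable.fintype_prod_dep fun i => (integrable_gaussianPDFReal 0 1).restrict
  · exact ae_of_all _ fun x => Finset.prod_nonneg fun i _ => gaussianPDFReal_nonneg _ _ _

lemma tPDF_pos {d : ℕ} (hd : 0 < d) (s : ℝ) : 0 < tPDF d s := by
  have hd' : (0 : ℝ) < d := by exact_mod_cast hd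
  have h1 := Real.Gamma_pos_of_pos (s := ((d : ℝ) + 1) / 2) (by positivity)
  have h2 := Real.Gamma_pos_of_pos (s := (d : ℝ) / 2) (by positivity)
  unfold tPDF
  positivity

lemma continuous_tPDF (d : ℕ) : Continuous (tPDF d) := by
  unfold tPDF
  refine continuous_const.mul (Continuous.rpow_const (by fun_prop) fun s => Or.inl ?_)
  positivity

/-- Radial integral of the joint density of a Gaussian vector and an independent scaled Gaussian,
which produces Student's density. -/
lemma integral_norm_gaussian_scale_mixture {d : ℕ} (hd : 0 < d) (s : ℝ) :
    ∫ x : EuclideanSpace ℝ (Fin d), (√(2 * Real.pi))⁻¹ ^ d * Real.exp (-‖x‖ ^ 2 / 2) *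
      (√(‖x‖ ^ 2 / d) * gaussianPDFReal 0 1 (√(‖x‖ ^ 2 / d) * s)) = tPDF d s := by
  have hd' : (0 : ℝ) < d := by exact_mod_cast hd
  have : Nonempty (Fin d) := ⟨⟨0, hd⟩⟩
  have hc : 0 < 1 + s ^ 2 / d := by positivity
  have hradial : ∫ y in Set.Ioi (0 : ℝ), y ^ (d - 1) • ((√(2 * Real.pi))⁻¹ ^ d *
        Real.exp (-y ^ 2 / 2) * (√(y ^ 2 / d) * gaussianPDFReal 0 1 (√(y ^ 2 / d) * s))) =
      (√(2 * Real.pi))⁻¹ ^ (d + 1) / √d * ∫ y in Set.Ioi (0 : ℝ),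
        y ^ (d : ℝ) * Real.exp (-((1 + s ^ 2 / d) / 2) * y ^ (2 : ℝ)) := by
    rw [← integral_const_mul]
    refine setIntegral_congr_fun measurableSet_Ioi fun y hy => ?_
    have hy : 0 < y := hy
    have hexp : Real.exp (-((1 + s ^ 2 / d) / 2) * y ^ (2 : ℝ)) =
        Real.exp (-y ^ 2 / 2) * Real.exp (-(√(y ^ 2 / d) * s) ^ 2 / 2) := by
      rw [← Real.exp_add, mul_pow, Real.sq_sqrt (by positivity), Real.rpow_two]
      congr 1
      field_simp
      ring
    have hpow : y ^ (d : ℝ) = y ^ (d - 1) * y := by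
      rw [Real.rpow_natCast, ← pow_succ, Nat.sub_add_cancel hd]
    simp only [hexp, hpow, gaussianPDFReal_def, smul_eq_mul, sub_zero, NNReal.coe_one, mul_one]
    rw [Real.sqrt_div (by positivity) (d : ℝ), Real.sqrt_sq hy.le]
    ring
  rw [integral_fun_norm_addHaar volume fun r : ℝ => (√(2 * Real.pi))⁻¹ ^ d *
    Real.exp (-r ^ 2 / 2) * (√(r ^ 2 / d) * gaussianPDFReal 0 1 (√(r ^ 2 / d) * s))]
  rw [finrank_euclideanSpace_fin, hradial,
    integral_rpow_mul_exp_neg_mul_rpow two_pos (by linarith) (by positivity),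
    measureReal_def, EuclideanSpace.volume_ball]
  have hG := Real.Gamma_pos_of_pos (s := (d : ℝ) / 2) (by positivity)
  rw [Real.Gamma_add_one (s := (Fintype.card (Fin d) : ℝ) / 2) (by simpa using hd.ne')]
  simp only [ENNReal.ofReal_one, one_pow, one_mul, Fintype.card_fin]
  rw [ENNReal.toReal_ofReal (by positivity), Real.div_rpow hc.le two_pos.le]
  have h2 : (2 : ℝ) ^ (-((d : ℝ) + 1) / 2) = (√2 ^ (d + 1))⁻¹ := by
    rw [Real.sqrt_eq_rpow, ← Real.rpow_natCast, ← Real.rpow_mul two_pos.le,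
      ← Real.rpow_neg two_pos.le]
    congr 1
    push_cast
    ring
  rw [h2, tPDF, Real.sqrt_mul two_pos.le, Real.sqrt_mul hd'.le, nsmul_eq_mul, smul_eq_mul,
    inv_pow, mul_pow, pow_succ √Real.pi]
  field_simp

lemma lintegral_gaussian_scale_mixture {d : ℕ} (hd : 0 < d) (s : ℝ) :
    ∫⁻ z, ENNReal.ofReal (√((∑ i, z i ^ 2) / d) * gaussianPDFReal 0 1 (√((∑ i, z i ^ 2) / d) * s))
      ∂(Measure.pi fun _ : Fin d => gaussianReal 0 1) = ENNReal.ofReal (tPDF d s) := by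
  have hmeas : Measurable fun z : Fin d → ℝ => ENNReal.ofReal
      (√((∑ i, z i ^ 2) / d) * gaussianPDFReal 0 1 (√((∑ i, z i ^ 2) / d) * s)) := by
    have := measurable_gaussianPDFReal 0 1
    fun_prop
  have hint := integral_norm_gaussian_scale_mixture hd s
  rw [pi_gaussianReal_eq_withDensity, lintegral_withDensity_eq_lintegral_mul _ (by fun_prop) hmeas,
    ← (PiLp.volume_preserving_ofLp (Fin d)).lintegral_comp (by fun_prop), ← hint,
    ofReal_integral_eq_lintegral_ofReal]
  · refine lintegral_congr fun x => ?_
    rw [Pi.mul_apply, ← ENNReal.ofReal_mul (by positivity), EuclideanSpace.real_norm_sq_eq,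
      Fintype.card_fin]
  · exact Integrable.of_integral_ne_zero (hint ▸ (tPDF_pos hd s).ne')
  · refine ae_of_all _ fun x => ?_
    have := gaussianPDFReal_nonneg 0 1 (√(‖x‖ ^ 2 / d) * s)
    simp only [Pi.zero_apply]
    positivity

/-- A centred interval of half-length `η * r` has the mass of `(-η, η]` under the rescaled
Gaussian. -/
lemma gaussianReal_abs_div_lt {η r : ℝ} (hη : 0 < η) (hr : 0 < r) :
    gaussianReal 0 1 {u | |u / r| < η} =
      ∫⁻ s in Set.Ioc (-η) η, ENNReal.ofReal (r * gaussianPDFReal 0 1 (r * s)) := by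
  have hset : {u : ℝ | |u / r| < η} = Set.Ioo (r * -η) (r * η) := by
    ext u
    rw [Set.mem_ofPred_eq, abs_lt, lt_div_iff₀ hr, div_lt_iff₀ hr, Set.mem_Ioo, mul_comm (-η),
      mul_comm η]
  have hφ : Integrable fun s => r * gaussianPDFReal 0 1 (r * s) :=
    ((integrable_gaussianPDFReal 0 1).comp_mul_left' hr.ne').const_mul r
  rw [hset, gaussianReal_apply_eq_integral 0 one_ne_zero, ← integral_Ioc_eq_integral_Ioo,
    ← intervalIntegral.integral_of_le (by nlinarith),
    ← intervalIntegral.smul_integral_comp_mul_left, smul_eq_mul,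
    ← intervalIntegral.integral_const_mul, intervalIntegral.integral_of_le (by linarith),
    ofReal_integral_eq_lintegral_ofReal hφ.restrict]
  exact ae_of_all _ fun s => mul_nonneg hr.le (gaussianPDFReal_nonneg _ _ _)

/-- The ratio of a standard Gaussian and the root mean square of `d` further independent ones
has Student's density with `d` degrees of freedom. -/
lemma prod_gaussian_abs_ratio_lt {d : ℕ} (hd : 0 < d) {η : ℝ} (hη : 0 < η) :
    ((gaussianReal 0 1).prod (Measure.pi fun _ : Fin d => gaussianReal 0 1))
      {p | |p.1 / √((∑ i, p.2 i ^ 2) / d)| < η} =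
      ENNReal.ofReal (∫ s in Set.Ioc (-η) η, tPDF d s) := by
  have hd' : (0 : ℝ) < d := by exact_mod_cast hd
  have : Nonempty (Fin d) := ⟨⟨0, hd⟩⟩
  have hφ := measurable_gaussianPDFReal 0 1
  have hatom : NullSingletonClass (gaussianReal 0 1) :=
    nullSingletonClass_gaussianReal one_ne_zero
  have hpos : ∀ᵐ z ∂(Measure.pi fun _ : Fin d => gaussianReal 0 1),
      0 < √((∑ i, z i ^ 2) / d) := by
    have hne : ∀ᵐ z ∂(Measure.pi fun _ : Fin d => gaussianReal 0 1), z ≠ 0 := by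
      simp [ae_iff]
    filter_upwards [hne] with z hz
    obtain ⟨i, hi⟩ := Function.ne_iff.1 hz
    have : 0 < ∑ i, z i ^ 2 :=
      Finset.sum_pos' (fun i _ => sq_nonneg _) ⟨i, Finset.mem_univ i, by
        have : z i ≠ 0 := hi
        positivity⟩
    positivity
  rw [Measure.prod_apply_symm (measurableSet_lt (by fun_prop) (by fun_prop))]
  calc
    _ = ∫⁻ z, (∫⁻ s in Set.Ioc (-η) η, ENNReal.ofReal (√((∑ i, z i ^ 2) / d) *
          gaussianPDFReal 0 1 (√((∑ i, z i ^ 2) / d) * s)))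
          ∂(Measure.pi fun _ : Fin d => gaussianReal 0 1) := by
      refine lintegral_congr_ae ?_
      filter_upwards [hpos] with z hz using gaussianReal_abs_div_lt hη hz
    _ = ∫⁻ s in Set.Ioc (-η) η, ENNReal.ofReal (tPDF d s) := by
      rw [lintegral_lintegral_swap (by fun_prop)]
      simp_rw [lintegral_gaussian_scale_mixture hd]
    _ = _ := by
      rw [ofReal_integral_eq_lintegral_ofReal]
      · exact ((continuous_tPDF d).integrableOn_Icc).mono_set Set.Ioc_subset_Icc_self
      · exact ae_of_all _ fun s => (tPDF_pos hd s).le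

lemma sum_sq_sub_mean {ι : Type*} [Fintype ι] [Nonempty ι] (x : ι → ℝ) :
    ∑ k, (x k - (∑ j, x j) / Fintype.card ι) ^ 2 =
      ∑ k, x k ^ 2 - (∑ k, x k) ^ 2 / Fintype.card ι := by
  have h : (Fintype.card ι : ℝ) ≠ 0 := by exact_mod_cast Fintype.card_ne_zero
  simp only [sub_sq, Finset.sum_add_distrib, Finset.sum_sub_distrib, ← Finset.sum_mul,
    ← Finset.mul_sum, Finset.sum_const, Finset.card_univ, nsmul_eq_mul]
  field_simp
  ring

/-- There is an orthonormal basis whose first vector is proportional to `(1, …, 1)`. -/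
lemma exists_orthonormalBasis_inner_eq_sum (d : ℕ) :
    ∃ b : OrthonormalBasis (Fin (d + 1)) ℝ (EuclideanSpace ℝ (Fin (d + 1))),
      ∀ x : EuclideanSpace ℝ (Fin (d + 1)), ∑ k, x k = √((d : ℝ) + 1) * b.repr x 0 := by
  have hs : √((d : ℝ) + 1) ≠ 0 := by positivity
  let w : EuclideanSpace ℝ (Fin (d + 1)) := WithLp.toLp 2 fun _ => (√((d : ℝ) + 1))⁻¹
  have hw : ‖w‖ = 1 := by
    rw [← sq_eq_sq₀ (norm_nonneg _) zero_le_one, EuclideanSpace.real_norm_sq_eq]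
    have : (0 : ℝ) ≤ (d : ℝ) + 1 := by positivity
    simp [w, Real.sq_sqrt this]
    field_simp
  obtain ⟨b, hb⟩ := Orthonormal.exists_orthonormalBasis_extension_of_card_eq (𝕜 := ℝ)
    (E := EuclideanSpace ℝ (Fin (d + 1))) (ι := Fin (d + 1)) (by simp) (v := fun _ => w)
    (s := {0}) (by
      rw [orthonormal_iff_ite]
      rintro ⟨i, rfl⟩ ⟨j, rfl⟩
      simp [Set.domRestrict, hw])
  refine ⟨b, fun x => ?_⟩
  rw [b.repr_apply_apply, hb 0 rfl, PiLp.inner_apply]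
  simp only [w, RCLike.inner_apply, conj_trivial, ← Finset.sum_mul]
  field_simp

/-- If `X₁,…,Xₙ` are i.i.d. standard normal with `n ≥ 2`, then
`T(x) = μ̄(x)/(σ̄'(x)/√n)`, where `σ̄'(x) = √(Σ(xₖ−μ̄(x))²/(n−1))`, has Student's
t-distribution with `n−1` degrees of freedom: for all `η > 0`,
`P(|T| ≥ η) = 1 − ∫_{−η}^{η} p^t_{n−1}(s) ds`. -/
theorem student_t_statistic (n : ℕ) (hn : 2 ≤ n) (η : ℝ) (hη : 0 < η) :
    (Measure.pi fun _ : Fin n => gaussianReal 0 1)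
        {x | η ≤
          |((∑ k, x k) / n) /
            (Real.sqrt ((∑ k, (x k - (∑ j, x j) / n) ^ 2) / (n - 1)) / Real.sqrt n)|} =
      ENNReal.ofReal (1 - ∫ s in Set.Ioc (-η) η, tPDF (n - 1) s) := by
  obtain ⟨d, rfl⟩ : ∃ d, n = d + 1 := ⟨n - 1, by omega⟩
  have hd : 0 < d := by omega
  obtain ⟨b, hb⟩ := exists_orthonormalBasis_inner_eq_sum d
  set P := Measure.pi fun _ : Fin (d + 1) => gaussianReal 0 1 with hP
  set T : (Fin (d + 1) → ℝ) → ℝ := fun x => ((∑ k, x k) / (d + 1 : ℕ)) /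
    (√((∑ k, (x k - (∑ j, x j) / (d + 1 : ℕ)) ^ 2) / ((d + 1 : ℕ) - 1)) / √(d + 1 : ℕ)) with hT
  have hTm : Measurable T := by fun_prop
  have hA : MeasurableSet {x | |T x| < η} := measurableSet_lt (by fun_prop) (by fun_prop)
  have hratio (y : Fin (d + 1) → ℝ) : T (WithLp.ofLp (∑ i, y i • b i)) =
      y 0 / √((∑ i : Fin d, y i.succ ^ 2) / d) := by
    set x := ∑ i, y i • b i
    have hrepr : b.repr x = WithLp.toLp 2 y := by
      rw [← b.repr.apply_symm_apply (WithLp.toLp 2 y), ← b.sum_repr_symm]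
    have hsum : ∑ k, x k = √((d : ℝ) + 1) * y 0 := by rw [hb, hrepr]
    have hsq : ∑ k, x k ^ 2 = y 0 ^ 2 + ∑ i : Fin d, y i.succ ^ 2 := by
      rw [← EuclideanSpace.real_norm_sq_eq, ← b.repr.norm_map, hrepr,
        EuclideanSpace.real_norm_sq_eq, Fin.sum_univ_succ]
    have hvar := sum_sq_sub_mean (WithLp.ofLp x)
    have h1 : (0 : ℝ) < (d : ℝ) + 1 := by positivity
    rw [Fintype.card_fin, hsq, hsum, mul_pow] at hvar
    push_cast at hvar
    rw [Real.sq_sqrt h1.le, mul_div_cancel_left₀ _ h1.ne', add_sub_cancel_left] at hvar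
    simp only [hT, hsum]
    push_cast
    rw [hvar, add_sub_cancel_right]
    have h3 : √((d : ℝ) + 1) * y 0 / (d + 1) * √((d : ℝ) + 1) = y 0 := by
      rw [div_mul_eq_mul_div, mul_right_comm, Real.mul_self_sqrt h1.le,
        mul_div_cancel_left₀ _ h1.ne']
    rw [div_div_eq_mul_div, h3]
  have hlt : P {x | |T x| < η} = ENNReal.ofReal (∫ s in Set.Ioc (-η) η, tPDF d s) := by
    have hpre := (measurePreserving_piFinSuccAbove
      (fun _ : Fin (d + 1) => gaussianReal 0 1) 0).measure_preimage
        (s := {p | |p.1 / √((∑ i, p.2 i ^ 2) / d)| < η})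
        (measurableSet_lt (by fun_prop) (by fun_prop)).nullMeasurableSet
    calc
      _ = (P.map (WithLp.toLp 2)) {x : EuclideanSpace ℝ (Fin (d + 1)) | |T x.ofLp| < η} := by
        rw [Measure.map_apply (by fun_prop) (measurableSet_lt (by fun_prop) (by fun_prop))]
        rfl
      _ = P {y | |T (WithLp.ofLp (∑ i, y i • b i))| < η} := by
        rw [hP, map_pi_eq_stdGaussian, stdGaussian_eq_map_pi_orthonormalBasis b,
          Measure.map_apply (by fun_prop) (measurableSet_lt (by fun_prop) (by fun_prop))]
        rfl
      _ = P {y | |y 0 / √((∑ i : Fin d, y i.succ ^ 2) / d)| < η} := by simp_rw [hratio]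
      _ = _ := by
        rw [← prod_gaussian_abs_ratio_lt hd hη, ← hpre]
        rfl
  have hcompl : {x | η ≤ |T x|} = {x | |T x| < η}ᶜ := by
    ext x
    simp
  change P {x | η ≤ |T x|} = _
  rw [hcompl, prob_compl_eq_one_sub hA, hlt, add_tsub_cancel_right, ENNReal.ofReal_sub,
    ENNReal.ofReal_one]
  exact integral_nonneg fun s => (tPDF_pos hd s).le
end
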